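/- A countable group G is left-orderable if and only if G is isomorphic to a subgroup of Homeo⁺(ℝ), the group of orientation-preserving homeomorphisms of the real line. -/

import Mathlib

/-- A left-order on a group `G`: a strict total order invariant under left-multiplication. -/
def IsLeftOrder {G : Type*} [Group G] (r : G → G → Prop) : Prop :=
  (∀ g, ¬ r g g) ∧ (∀ a b c, r a b → r b c → r a c) ∧
  (∀ a b, a ≠ b → r a b ∨ r b a) ∧
  ∀ f g h, r g h ↔ r (f * g) (f * h)

theorem ext_exists (f : ℚ ≃o ℚ) (x : ℝ) :
    ∃ y : ℝ, ∀ p : ℚ, (p : ℝ) < y ↔ ((f.symm p : ℚ) : ℝ) < x := by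
  have hne : {z : ℝ | ∃ p : ℚ, z = p ∧ ((f.symm p : ℚ) : ℝ) < x}.Nonempty := by
    obtain ⟨q, hq⟩ := exists_rat_lt x
    exact ⟨(f q : ℚ), f q, rfl, by simpa using hq⟩
  have hbd : BddAbove {z : ℝ | ∃ p : ℚ, z = p ∧ ((f.symm p : ℚ) : ℝ) < x} := by
    obtain ⟨q, hq⟩ := exists_rat_gt x
    refine ⟨(f q : ℚ), ?_⟩
    rintro z ⟨p, rfl, hp⟩
    have h1 : f.symm p < q := by exact_mod_cast hp.trans hq
    have h2 : p < f q := by simpa using f.strictMono h1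
    exact_mod_cast h2.le
  refine ⟨sSup {z : ℝ | ∃ p : ℚ, z = p ∧ ((f.symm p : ℚ) : ℝ) < x}, fun p => ?_⟩
  rw [lt_csSup_iff hbd hne]
  constructor
  · rintro ⟨z, ⟨p', rfl, hp'⟩, h⟩
    have h1 : p < p' := by exact_mod_cast h
    have h2 : f.symm p < f.symm p' := f.symm.strictMono h1
    have h3 : ((f.symm p : ℚ) : ℝ) < (f.symm p' : ℚ) := by exact_mod_cast h2
    exact h3.trans hp'
  · intro h
    obtain ⟨q, hq1, hq2⟩ := exists_rat_btwn h
    refine ⟨(f q : ℚ), ⟨f q, rfl, by simpa using hq2⟩, ?_⟩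
    have h1 : f.symm p < q := by exact_mod_cast hq1
    have h2 : p < f q := by simpa using f.strictMono h1
    exact_mod_cast h2

noncomputable def extFun (f : ℚ ≃o ℚ) (x : ℝ) : ℝ := (ext_exists f x).choose

theorem lt_extFun (f : ℚ ≃o ℚ) (x : ℝ) (p : ℚ) :
    (p : ℝ) < extFun f x ↔ ((f.symm p : ℚ) : ℝ) < x := (ext_exists f x).choose_spec p

theorem le_of_rat {x y : ℝ} (h : ∀ p : ℚ, (p : ℝ) < x → (p : ℝ) < y) : x ≤ y := by
  by_contra hlt
  obtain ⟨q, h1, h2⟩ := exists_rat_btwn (not_le.mp hlt)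
  exact absurd (h q h2) (not_lt.mpr h1.le)

theorem eq_of_rat {x y : ℝ} (h : ∀ p : ℚ, (p : ℝ) < x ↔ (p : ℝ) < y) : x = y :=
  le_antisymm (le_of_rat fun p => (h p).1) (le_of_rat fun p => (h p).2)

theorem extFun_mono (f : ℚ ≃o ℚ) : Monotone (extFun f) := fun x y h =>
  le_of_rat fun p hp => (lt_extFun f y p).2 (((lt_extFun f x p).1 hp).trans_le h)

theorem extFun_mul (f g : ℚ ≃o ℚ) (x : ℝ) : extFun (f * g) x = extFun f (extFun g x) :=
  eq_of_rat fun p => by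
    rw [lt_extFun, lt_extFun, lt_extFun]; rfl

theorem extFun_one (x : ℝ) : extFun 1 x = x :=
  eq_of_rat fun p => by
    rw [lt_extFun]; rfl

theorem extFun_rat (f : ℚ ≃o ℚ) (q : ℚ) : extFun f q = (f q : ℚ) :=
  eq_of_rat fun p => by
    rw [lt_extFun, Rat.cast_lt, Rat.cast_lt]
    exact f.symm_apply_lt

noncomputable def extIso (f : ℚ ≃o ℚ) : ℝ ≃o ℝ :=
  Equiv.toOrderIso
    { toFun := extFun f
      invFun := extFun f⁻¹
      left_inv := fun x => by rw [← extFun_mul, inv_mul_cancel, extFun_one]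
      right_inv := fun x => by rw [← extFun_mul, mul_inv_cancel, extFun_one] }
    (extFun_mono f) (extFun_mono f⁻¹)

noncomputable def extHom : (ℚ ≃o ℚ) →* (ℝ ≃o ℝ) where
  toFun := extIso
  map_one' := by ext x; exact extFun_one x
  map_mul' f g := by ext x; exact extFun_mul f g x

theorem extHom_injective : Function.Injective extHom := by
  intro f g h
  ext q
  have h1 : extFun f q = extFun g q := congrArg (fun e : ℝ ≃o ℝ => e q) h
  rw [extFun_rat, extFun_rat] at h1
  exact_mod_cast h1

theorem embed_rat {G : Type*} [Group G] [Countable G] (r : G → G → Prop)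
    (hr : IsLeftOrder r) : ∃ φ : G →* (ℚ ≃o ℚ), Function.Injective φ := by
  classical
  obtain ⟨h1, h2, h3, h4⟩ := hr
  let _ : LinearOrder G :=
    { le := fun a b => a = b ∨ r a b
      lt := r
      le_refl := fun a => Or.inl rfl
      le_trans := by
        rintro a b c (rfl | hab) (rfl | hbc)
        · exact Or.inl rfl
        · exact Or.inr hbc
        · exact Or.inr hab
        · exact Or.inr (h2 _ _ _ hab hbc)
      le_antisymm := by
        rintro a b (rfl | hab) (hba | hba)
        · rfl
        · rfl
        · exact hba.symm
        · exact absurd (h2 _ _ _ hab hba) (h1 a)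
      lt_iff_le_not_ge := by
        intro a b
        constructor
        · intro h
          refine ⟨Or.inr h, ?_⟩
          rintro (rfl | h')
          · exact h1 _ h
          · exact h1 _ (h2 _ _ _ h h')
        · rintro ⟨rfl | h, h'⟩
          · exact absurd (Or.inl rfl) h'
          · exact h
      le_total := by
        intro a b
        by_cases h : a = b
        · exact Or.inl (Or.inl h)
        · exact (h3 a b h).imp Or.inr Or.inr
      toDecidableLE := Classical.decRel _ }
  have hlt : ∀ f g h : G, f * g < f * h ↔ g < h := fun f g h => (h4 f g h).symm
  have : Countable (G ×ₗ ℚ) := inferInstanceAs (Countable (G × ℚ))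
  have : Nonempty (G ×ₗ ℚ) := inferInstanceAs (Nonempty (G × ℚ))
  obtain ⟨e⟩ := Order.iso_of_countable_dense (G ×ₗ ℚ) ℚ
  let m : G → (G ×ₗ ℚ) → (G ×ₗ ℚ) := fun g x => toLex (g * (ofLex x).1, (ofLex x).2)
  have hm : ∀ g, StrictMono (m g) := by
    intro g x y hxy
    rw [Prod.Lex.lt_iff] at hxy ⊢
    simpa [m, hlt] using hxy
  have mm : ∀ g h x, m (g * h) x = m g (m h x) := by
    intro g h x; simp [m, mul_assoc]
  have m1 : ∀ x, m 1 x = x := by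
    intro x; simp [m]
  let M : G → (ℚ ≃o ℚ) := fun g =>
    Equiv.toOrderIso
      { toFun := fun q => e (m g (e.symm q))
        invFun := fun q => e (m g⁻¹ (e.symm q))
        left_inv := fun q => by simp [← mm, m1]
        right_inv := fun q => by simp [← mm, m1] }
      (e.monotone.comp ((hm g).monotone.comp e.symm.monotone))
      (e.monotone.comp ((hm g⁻¹).monotone.comp e.symm.monotone))
  have hM : ∀ g q, M g q = e (m g (e.symm q)) := fun g q => rfl
  refine ⟨⟨⟨M, ?_⟩, ?_⟩, ?_⟩
  · ext q; simp [hM, m1]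
  · intro g h; ext q; simp [hM, mm, RelIso.mul_apply]
  · intro g h hgh
    have h5 : M g (e (toLex (1, 0))) = M h (e (toLex (1, 0))) :=
      congrArg (fun k : ℚ ≃o ℚ => k (e (toLex (1, 0)))) hgh
    rw [hM, hM] at h5
    have h6 := e.injective h5
    have h7 := congrArg (fun x => (ofLex x).1) h6
    simpa [m] using h7

theorem order_of_embed {G : Type*} [Group G] (φ : G →* (ℝ ≃o ℝ))
    (hφ : Function.Injective φ) : ∃ r : G → G → Prop, IsLeftOrder r := by
  refine ⟨fun a b => ∃ x : ℝ, (∀ y, WellOrderingRel y x → φ a y = φ b y) ∧ φ a x < φ b x,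
    ?_, ?_, ?_, ?_⟩
  · rintro g ⟨x, -, h⟩
    exact lt_irrefl _ h
  · rintro a b c ⟨x, hx, hx'⟩ ⟨y, hy, hy'⟩
    rcases trichotomous_of WellOrderingRel x y with h | rfl | h
    · exact ⟨x, fun z hz => (hx z hz).trans (hy z (_root_.trans hz h)), hx'.trans_eq (hy x h)⟩
    · exact ⟨x, fun z hz => (hx z hz).trans (hy z hz), hx'.trans hy'⟩
    · exact ⟨y, fun z hz => (hx z (_root_.trans hz h)).trans (hy z hz), (hx y h).trans_lt hy'⟩
  · intro a b hab
    have hne : {x : ℝ | φ a x ≠ φ b x}.Nonempty := by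
      by_contra hc
      apply hab
      apply hφ
      ext x
      by_contra hx
      exact hc ⟨x, hx⟩
    have wf : WellFounded (WellOrderingRel : ℝ → ℝ → Prop) := IsWellFounded.wf
    obtain ⟨x, hx, hmin⟩ := wf.has_min _ hne
    have hy : ∀ y, WellOrderingRel y x → φ a y = φ b y := by
      intro y hyx
      by_contra hc
      exact hmin y hc hyx
    rcases lt_or_gt_of_ne hx with h | h
    · exact Or.inl ⟨x, hy, h⟩
    · exact Or.inr ⟨x, fun y h' => (hy y h').symm, h⟩
  · intro f g h
    simp [RelIso.mul_apply]

/-- A countable group is left-orderable iff it is isomorphic to a subgroup of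
`Homeo⁺(ℝ) = (ℝ ≃o ℝ)`, the group of orientation-preserving homeomorphisms of `ℝ`. -/
theorem countable_leftOrderable_iff_subgroup_homeoPlus {G : Type*} [Group G]
    [Countable G] :
    (∃ r : G → G → Prop, IsLeftOrder r) ↔
      ∃ φ : G →* (ℝ ≃o ℝ), Function.Injective φ := by
  constructor
  · rintro ⟨r, hr⟩
    obtain ⟨φ, hφ⟩ := embed_rat r hr
    exact ⟨extHom.comp φ, extHom_injective.comp hφ⟩
  · rintro ⟨φ, hφ⟩
    exact order_of_embed φ hφ
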